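/- arXiv:1503.02424 — 3 statements merged into one kernel-verified Lean document; each statement's English description precedes it below -/
import Mathlib

section
/- Let Q be a positive integer, μ ∈ ℝ^Q, Σ a symmetric positive-definite Q×Q real matrix, x ∈ ℝ^Q, and b ∈ ℝ. Then ∫_{ℝ^Q} ((2π)^Q det Σ)^{-1/2} exp(−½ (w−μ)ᵀ Σ⁻¹ (w−μ)) · cos(⟨w, x⟩ + b) dw = exp(−½ xᵀ Σ x) · cos(⟨μ, x⟩ + b). -/
open Real MeasureTheory Matrix

/-- The standard Gaussian integral of a shifted plane cosine wave. -/
theorem integral_exp_neg_half_dotProduct_mul_cos {ι : Type*} [Fintype ι] (y : ι → ℝ) (c : ℝ) :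
    ∫ v : ι → ℝ, Real.exp (-(1/2) * (v ⬝ᵥ v)) * Real.cos ((v ⬝ᵥ y) + c) =
      (2 * π) ^ ((Fintype.card ι : ℝ) / 2) * (Real.exp (-(1/2) * (y ⬝ᵥ y)) * Real.cos c) := by
  have hb : 0 < ((1 / 2 : ℝ) : ℂ).re := by norm_num
  have hint := (GaussianFourier.integrable_cexp_neg_mul_sum_add hb
    (fun i ↦ Complex.I * y i)).mul_const (Complex.exp (c * Complex.I))
  have hval := GaussianFourier.integral_cexp_neg_mul_sum_add hb (fun i ↦ Complex.I * y i)
  have hpt (v : ι → ℝ) :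
      Real.exp (-(1/2) * (v ⬝ᵥ v)) * Real.cos ((v ⬝ᵥ y) + c) =
        Complex.reCLM (Complex.exp (-((1 / 2 : ℝ) : ℂ) * ∑ i, (v i : ℂ) ^ 2 +
          ∑ i, Complex.I * y i * v i) * Complex.exp (c * Complex.I)) := by
    have : -((1 / 2 : ℝ) : ℂ) * ∑ i, (v i : ℂ) ^ 2 + ∑ i, Complex.I * y i * v i + c * Complex.I =
        ((-(1/2) * (v ⬝ᵥ v) : ℝ) : ℂ) + (((v ⬝ᵥ y) + c : ℝ) : ℂ) * Complex.I := by
      simp only [dotProduct]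
      push_cast
      simp only [add_mul, Finset.sum_mul, add_assoc]
      congr 2
      · simp [sq]
      · congr 2
        funext i
        ring
    rw [← Complex.exp_add, this, Complex.reCLM_apply, Complex.exp_re]
    simp
  have hone : (∑ i, (Complex.I * y i) ^ 2) / (4 * ((1 / 2 : ℝ) : ℂ)) =
      ((-(1/2) * (y ⬝ᵥ y) : ℝ) : ℂ) := by
    simp only [dotProduct, mul_pow, Complex.I_sq, ← Finset.mul_sum]
    push_cast
    simp only [sq]
    ring
  have hpow : ((π : ℂ) / ((1 / 2 : ℝ) : ℂ)) ^ (Fintype.card ι / 2 : ℂ) =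
      (((2 * π) ^ ((Fintype.card ι : ℝ) / 2) : ℝ) : ℂ) := by
    rw [Complex.ofReal_cpow (by positivity)]
    push_cast
    congr 1
    ring
  simp_rw [hpt]
  rw [ContinuousLinearMap.integral_comp_comm _ hint, integral_mul_const, hval, hone, hpow,
    ← Complex.ofReal_exp, mul_assoc, Complex.reCLM_apply, Complex.re_ofReal_mul,
    Complex.re_ofReal_mul, Complex.exp_ofReal_mul_I_re]

/-- Linear change of variables by an invertible matrix. -/
theorem integral_comp_mulVec {ι : Type*} [Fintype ι] [DecidableEq ι] {M : Matrix ι ι ℝ}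
    (hM : M.det ≠ 0) (f : (ι → ℝ) → ℝ) :
    ∫ v, f v = |M.det| * ∫ v, f (M *ᵥ v) := by
  have hemb : MeasurableEmbedding (toLin' M) :=
    ((LinearEquiv.ofIsUnitDet (f := toLin' M) (v := Pi.basisFun ℝ ι) (v' := Pi.basisFun ℝ ι)
      (by simpa using hM)).toContinuousLinearEquiv.toHomeomorph).measurableEmbedding
  have h := hemb.integral_map (μ := volume) f
  rw [Real.map_matrix_volume_pi_eq_smul_volume_pi hM, integral_smul_measure,
    ENNReal.toReal_ofReal (abs_nonneg _), abs_inv, smul_eq_mul] at h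
  simp only [toLin'_apply] at h
  rw [← h, mul_inv_cancel_left₀ (abs_ne_zero.mpr hM)]

theorem stmt_3 (Q : ℕ) (hQ : 0 < Q) (μ : Fin Q → ℝ) (S : Matrix (Fin Q) (Fin Q) ℝ)
    (hS : S.PosDef) (x : Fin Q → ℝ) (b : ℝ) :
    ∫ w : Fin Q → ℝ,
        ((2 * π) ^ Q * S.det) ^ (-(1:ℝ)/2) *
          Real.exp (-(1/2) * ((w - μ) ⬝ᵥ (S⁻¹ *ᵥ (w - μ)))) *
          Real.cos ((w ⬝ᵥ x) + b) =
      Real.exp (-(1/2) * (x ⬝ᵥ (S *ᵥ x))) * Real.cos ((μ ⬝ᵥ x) + b) := by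
  obtain ⟨B, hB⟩ : ∃ B : Matrix (Fin Q) (Fin Q) ℝ, S = Bᵀ * B := by
    open scoped MatrixOrder Matrix.Norms.L2Operator in
    obtain ⟨B, hB⟩ := CStarAlgebra.nonneg_iff_eq_star_mul_self.mp hS.posSemidef.nonneg
    exact ⟨B, by simpa [star_eq_conjTranspose] using hB⟩
  have hdet : S.det = B.det ^ 2 := by rw [hB, det_mul, det_transpose, sq]
  have hB0 : B.det ≠ 0 := fun h ↦ hS.det_pos.ne' (by simp [hdet, h])
  have hBu : IsUnit B.det := hB0.isUnit
  have hquad (v : Fin Q → ℝ) : (Bᵀ *ᵥ v) ⬝ᵥ (S⁻¹ *ᵥ (Bᵀ *ᵥ v)) = v ⬝ᵥ v := by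
    have : B * (S⁻¹ * Bᵀ) = 1 := by
      rw [hB, Matrix.mul_inv_rev, Matrix.mul_assoc, nonsing_inv_mul _ (by simpa using hBu),
        Matrix.mul_one, mul_nonsing_inv _ hBu]
    rw [mulVec_transpose, ← dotProduct_mulVec, ← mulVec_transpose, mulVec_mulVec, mulVec_mulVec,
      Matrix.mul_assoc, this,
      one_mulVec]
  have hvar : x ⬝ᵥ (S *ᵥ x) = (B *ᵥ x) ⬝ᵥ (B *ᵥ x) := by
    rw [hB, ← mulVec_mulVec, dotProduct_mulVec, vecMul_transpose]
  have hlin (v : Fin Q → ℝ) : (Bᵀ *ᵥ v + μ) ⬝ᵥ x + b = v ⬝ᵥ (B *ᵥ x) + ((μ ⬝ᵥ x) + b) := by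
    rw [add_dotProduct, mulVec_transpose, ← dotProduct_mulVec, add_assoc]
  have hnorm : ((2 * π) ^ Q * S.det) ^ (-(1:ℝ)/2) * (|B.det| * (2 * π) ^ ((Q : ℝ) / 2)) = 1 := by
    have h2 : |B.det| * (2 * π) ^ ((Q : ℝ) / 2) = ((2 * π) ^ Q * S.det) ^ ((1:ℝ)/2) := by
      rw [Real.mul_rpow (by positivity) hS.det_pos.le, hdet, ← Real.sqrt_eq_rpow (B.det ^ 2),
        Real.sqrt_sq_eq_abs, ← Real.rpow_natCast, ← Real.rpow_mul (by positivity), mul_comm]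
      ring_nf
    have hpos : 0 < (2 * π) ^ Q * S.det := mul_pos (by positivity) hS.det_pos
    rw [h2, ← Real.rpow_add hpos]
    norm_num
  rw [← integral_add_right_eq_self _ μ,
    integral_comp_mulVec (M := Bᵀ) (by rwa [det_transpose])]
  simp only [add_sub_cancel_right, hquad, hlin, mul_assoc, det_transpose]
  rw [integral_const_mul, integral_exp_neg_half_dotProduct_mul_cos, Fintype.card_fin, hvar]
  linear_combination
    (Real.exp (-(1/2) * ((B *ᵥ x) ⬝ᵥ (B *ᵥ x))) * Real.cos ((μ ⬝ᵥ x) + b)) * hnorm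
end

section
/- Let Q be a positive integer, μ ∈ ℝ^Q, Σ a symmetric positive-definite Q×Q real matrix, x ∈ ℝ^Q, and b ∈ ℝ. Then ∫_{ℝ^Q} ((2π)^Q det Σ)^{-1/2} exp(−½ (w−μ)ᵀ Σ⁻¹ (w−μ)) · cos(⟨w, x⟩ + b)² dw = ½ · exp(−2 xᵀ Σ x) · cos(2⟨μ, x⟩ + 2b) + ½. -/
open Real MeasureTheory Matrix

/-- A real positive definite matrix factors as `B * Bᵀ` with `B` invertible. -/
lemma exists_eq_mul_transpose_of_posDef {ι : Type*} [Fintype ι] [DecidableEq ι]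
    {S : Matrix ι ι ℝ} (hS : S.PosDef) :
    ∃ B : Matrix ι ι ℝ, IsUnit B ∧ S = B * Bᵀ := by
  open scoped MatrixOrder Matrix.Norms.L2Operator in
  obtain ⟨B, hB, h⟩ := CStarAlgebra.isStrictlyPositive_iff_eq_mul_star_self.mp
    hS.isStrictlyPositive
  exact ⟨B, hB, by simpa [star_eq_conjTranspose, conjTranspose_eq_transpose_of_trivial] using h⟩

/-- Invertible affine change of variables for a continuous integrand. -/
lemma integral_eq_abs_det_mul_integral_mulVec_add {ι : Type*} [Fintype ι] [DecidableEq ι]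
    {B : Matrix ι ι ℝ} (hB : B.det ≠ 0) (m : ι → ℝ) {f : (ι → ℝ) → ℝ} (hf : Continuous f) :
    ∫ w, f w = |B.det| * ∫ v, f (B *ᵥ v + m) := by
  have hc : Continuous fun w ↦ f (w + m) := by fun_prop
  have h := integral_map (μ := (volume : Measure (ι → ℝ)))
    (φ := toLin' B) (f := fun w ↦ f (w + m))
    (LinearMap.continuous_on_pi _).measurable.aemeasurable hc.aestronglyMeasurable
  rw [Real.map_matrix_volume_pi_eq_smul_volume_pi hB, integral_smul_measure,
    ENNReal.toReal_ofReal (abs_nonneg _), integral_add_right_eq_self f m] at h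
  simp only [toLin'_apply, smul_eq_mul] at h
  rw [← h, ← mul_assoc, ← abs_mul, mul_inv_cancel₀ hB, abs_one, one_mul]

lemma cexp_gaussian_phase_eq {ι : Type*} [Fintype ι] (c : ι → ℝ) (d : ℝ) (v : ι → ℝ) :
    Complex.exp (-(1 / 2 : ℂ) * ∑ i, (v i : ℂ) ^ 2 + ∑ i, (c i * Complex.I) * v i) *
        Complex.exp (d * Complex.I) =
      (rexp (-(1 / 2) * (v ⬝ᵥ v)) : ℂ) * Complex.exp (((v ⬝ᵥ c + d : ℝ) : ℂ) * Complex.I) := by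
  rw [← Complex.exp_add, Complex.ofReal_exp, ← Complex.exp_add]
  congr 1
  have h : ∑ i, (c i * Complex.I) * v i = ((v ⬝ᵥ c : ℝ) : ℂ) * Complex.I := by
    simp only [dotProduct, Complex.ofReal_sum, Complex.ofReal_mul, Finset.sum_mul]
    exact Finset.sum_congr rfl fun i _ ↦ by ring
  rw [h]
  simp only [dotProduct]
  push_cast
  simp only [pow_two]
  ring

lemma integrable_exp_neg_half_mul_cos {ι : Type*} [Fintype ι] (c : ι → ℝ) (d : ℝ) :
    Integrable fun v : ι → ℝ ↦ rexp (-(1 / 2) * (v ⬝ᵥ v)) * cos (v ⬝ᵥ c + d) := by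
  have h := ((GaussianFourier.integrable_cexp_neg_mul_sum_add (b := 1 / 2) (by norm_num)
    fun i ↦ c i * Complex.I).mul_const (Complex.exp (d * Complex.I))).re
  simp_rw [cexp_gaussian_phase_eq] at h
  simpa only [RCLike.re_to_complex, Complex.re_ofReal_mul, Complex.exp_ofReal_mul_I_re] using h

lemma integral_exp_neg_half_mul_cos {ι : Type*} [Fintype ι] (c : ι → ℝ) (d : ℝ) :
    ∫ v : ι → ℝ, rexp (-(1 / 2) * (v ⬝ᵥ v)) * cos (v ⬝ᵥ c + d) =
      (2 * π) ^ (Fintype.card ι / 2 : ℝ) * (rexp (-(1 / 2) * (c ⬝ᵥ c)) * cos d) := by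
  have hb : 0 < (1 / 2 : ℂ).re := by norm_num
  have hi := (GaussianFourier.integrable_cexp_neg_mul_sum_add hb
    fun i ↦ c i * Complex.I).mul_const (Complex.exp (d * Complex.I))
  have h := congrArg (· * Complex.exp (d * Complex.I))
    (GaussianFourier.integral_cexp_neg_mul_sum_add hb fun i ↦ c i * Complex.I)
  simp only [← integral_mul_const] at h
  have h2 := integral_re hi
  rw [h] at h2
  simp_rw [cexp_gaussian_phase_eq] at h2
  simp only [RCLike.re_to_complex, Complex.re_ofReal_mul, Complex.exp_ofReal_mul_I_re] at h2
  rw [h2]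
  have h3 : (π / (1 / 2) : ℂ) ^ (Fintype.card ι / 2 : ℂ) =
      (((2 * π) ^ (Fintype.card ι / 2 : ℝ) : ℝ) : ℂ) := by
    rw [Complex.ofReal_cpow (by positivity)]
    push_cast
    congr 1
    ring
  have h4 : Complex.exp ((∑ i, (c i * Complex.I) ^ 2) / (4 * (1 / 2))) =
      (rexp (-(1 / 2) * (c ⬝ᵥ c)) : ℂ) := by
    rw [Complex.ofReal_exp]
    congr 1
    simp only [mul_pow, Complex.I_sq, dotProduct]
    push_cast
    rw [← Finset.sum_mul]
    simp only [pow_two]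
    ring
  rw [h3, h4, mul_assoc, Complex.re_ofReal_mul, Complex.re_ofReal_mul,
    Complex.exp_ofReal_mul_I_re]

theorem stmt_6 (Q : ℕ) (hQ : 0 < Q) (μ : Fin Q → ℝ) (S : Matrix (Fin Q) (Fin Q) ℝ)
    (hS : S.PosDef) (x : Fin Q → ℝ) (b : ℝ) :
    ∫ w : Fin Q → ℝ,
        ((2 * π) ^ Q * S.det) ^ (-(1:ℝ)/2) *
          Real.exp (-(1/2) * ((w - μ) ⬝ᵥ (S⁻¹ *ᵥ (w - μ)))) *
          Real.cos ((w ⬝ᵥ x) + b) ^ 2 =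
      1 / 2 * Real.exp (-2 * (x ⬝ᵥ (S *ᵥ x))) * Real.cos (2 * (μ ⬝ᵥ x) + 2 * b) + 1 / 2 := by
  obtain ⟨B, hB, rfl⟩ := exists_eq_mul_transpose_of_posDef hS
  have hu : IsUnit B.det := (isUnit_iff_isUnit_det B).mp hB
  have hu' : IsUnit Bᵀ.det := by rwa [det_transpose]
  have hquad (v : Fin Q → ℝ) : (B *ᵥ v) ⬝ᵥ ((B * Bᵀ)⁻¹ *ᵥ (B *ᵥ v)) = v ⬝ᵥ v := by
    rw [Matrix.mul_inv_rev, mulVec_mulVec, Matrix.mul_assoc, nonsing_inv_mul _ hu, Matrix.mul_one,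
      ← vecMul_transpose, ← dotProduct_mulVec, mulVec_mulVec, mul_nonsing_inv _ hu', one_mulVec]
  have hlin (v : Fin Q → ℝ) : (B *ᵥ v) ⬝ᵥ x = v ⬝ᵥ (Bᵀ *ᵥ x) := by
    rw [← vecMul_transpose, ← dotProduct_mulVec]
  have hform : (Bᵀ *ᵥ x) ⬝ᵥ (Bᵀ *ᵥ x) = x ⬝ᵥ ((B * Bᵀ) *ᵥ x) := by
    rw [← hlin, mulVec_mulVec, dotProduct_comm]
  have hconst : ((2 * π) ^ Q * (B * Bᵀ).det) ^ (-(1:ℝ)/2) * |B.det| *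
      (2 * π) ^ (Q / 2 : ℝ) = 1 := by
    have hpos : 0 < |B.det| := abs_pos.mpr hu.ne_zero
    have hpow : ((2 * π) ^ Q * (B * Bᵀ).det) = ((2 * π) ^ (Q / 2 : ℝ) * |B.det|) ^ (2 : ℝ) := by
      rw [mul_rpow (by positivity) hpos.le, ← rpow_mul (by positivity), div_mul_cancel₀ _ two_ne_zero,
        rpow_natCast, rpow_two, sq_abs, det_mul, det_transpose, pow_two B.det]
    rw [hpow, ← rpow_mul (by positivity), show (2 : ℝ) * (-1 / 2) = -1 by norm_num, rpow_neg_one]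
    field_simp
  have hcos (v : Fin Q → ℝ) :
      ((2 * π) ^ Q * (B * Bᵀ).det) ^ (-(1:ℝ)/2) *
          rexp (-(1/2) * ((B *ᵥ v + μ - μ) ⬝ᵥ ((B * Bᵀ)⁻¹ *ᵥ (B *ᵥ v + μ - μ)))) *
          cos (((B *ᵥ v + μ) ⬝ᵥ x) + b) ^ 2 =
        ((2 * π) ^ Q * (B * Bᵀ).det) ^ (-(1:ℝ)/2) / 2 *
          (rexp (-(1 / 2) * (v ⬝ᵥ v)) * cos (v ⬝ᵥ (0 : Fin Q → ℝ) + 0) +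
            rexp (-(1 / 2) * (v ⬝ᵥ v)) *
              cos (v ⬝ᵥ ((2 : ℝ) • (Bᵀ *ᵥ x)) + (2 * (μ ⬝ᵥ x) + 2 * b))) := by
    rw [add_sub_cancel_right, hquad, add_dotProduct, hlin, cos_sq, dotProduct_zero, add_zero,
      cos_zero, dotProduct_smul, smul_eq_mul,
      show 2 * (v ⬝ᵥ (Bᵀ *ᵥ x) + μ ⬝ᵥ x + b) =
        2 * (v ⬝ᵥ (Bᵀ *ᵥ x)) + (2 * (μ ⬝ᵥ x) + 2 * b) by ring]
    ring
  rw [integral_eq_abs_det_mul_integral_mulVec_add hu.ne_zero μ (by fun_prop)]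
  simp_rw [hcos]
  rw [integral_const_mul, integral_add (integrable_exp_neg_half_mul_cos _ _)
    (integrable_exp_neg_half_mul_cos _ _), integral_exp_neg_half_mul_cos,
    integral_exp_neg_half_mul_cos, Fintype.card_fin, dotProduct_smul, smul_dotProduct, hform,
    dotProduct_zero, mul_zero, exp_zero, cos_zero, smul_eq_mul, smul_eq_mul,
    show -(1 / 2 : ℝ) * (2 * (2 * (x ⬝ᵥ ((B * Bᵀ) *ᵥ x)))) = -2 * (x ⬝ᵥ ((B * Bᵀ) *ᵥ x)) by ring]
  linear_combination (1 / 2 + 1 / 2 * rexp (-2 * (x ⬝ᵥ ((B * Bᵀ) *ᵥ x))) *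
    cos (2 * (μ ⬝ᵥ x) + 2 * b)) * hconst
end

section
/- Let Q be a positive integer, μ ∈ ℝ^Q, Σ a symmetric positive-definite Q×Q real matrix, x ∈ ℝ^Q, c ∈ ℝ, and let α < β be real numbers. Then ∫_{ℝ^Q} ((2π)^Q det Σ)^{-1/2} exp(−½ (w−μ)ᵀ Σ⁻¹ (w−μ)) · ( (1/(β−α)) ∫_{α}^{β} cos(⟨w, x⟩ + b + c) db ) dw = exp(−½ xᵀ Σ x) · ( sin(⟨μ, x⟩ + c + β) − sin(⟨μ, x⟩ + c + α) ) / (β − α). -/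
open Real MeasureTheory Matrix

open scoped MatrixOrder in
theorem Matrix.PosDef.exists_mul_transpose {n : Type*} [Fintype n] [DecidableEq n]
    {S : Matrix n n ℝ} (hS : S.PosDef) : ∃ A : Matrix n n ℝ, A.det ≠ 0 ∧ S = A * Aᵀ := by
  obtain ⟨B, rfl⟩ := CStarAlgebra.nonneg_iff_eq_star_mul_self.mp hS.posSemidef.nonneg
  refine ⟨Bᵀ, fun h => hS.det_pos.ne' ?_, by simp [star_eq_conjTranspose]⟩
  rw [det_mul, ← det_transpose B, h, mul_zero]

theorem integral_comp_add_mulVec {n : Type*} [Fintype n] [DecidableEq n] {A : Matrix n n ℝ}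
    (hA : A.det ≠ 0) (m : n → ℝ) (f : (n → ℝ) → ℝ) :
    ∫ w, f w = |A.det| * ∫ v, f (m + A *ᵥ v) := by
  have hemb : MeasurableEmbedding (Matrix.toLin' A) :=
    ((Matrix.toLin'OfInv (M := A⁻¹) (M' := A) (Matrix.nonsing_inv_mul _ hA.isUnit)
      (Matrix.mul_nonsing_inv _ hA.isUnit)).toContinuousLinearEquiv.toHomeomorph).measurableEmbedding
  have h := hemb.integral_map (μ := volume) (fun w => f (m + w))
  rw [Real.map_matrix_volume_pi_eq_smul_volume_pi hA, integral_smul_measure,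
    ENNReal.toReal_ofReal (abs_nonneg _), integral_add_left_eq_self, smul_eq_mul, abs_inv] at h
  simp only [Matrix.toLin'_apply] at h
  rw [← h, mul_inv_cancel_left₀ (abs_ne_zero.mpr hA)]

theorem integral_exp_neg_dotProduct_mul_im {n : Type*} [Fintype n] (y : n → ℝ) (z : ℂ) :
    ∫ v : n → ℝ, Real.exp (-(1/2) * (v ⬝ᵥ v)) * (z * Complex.exp ((v ⬝ᵥ y : ℝ) * Complex.I)).im =
      (2 * π) ^ ((Fintype.card n : ℝ) / 2) * Real.exp (-(1/2) * (y ⬝ᵥ y)) * z.im := by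
  have hb : 0 < (1 / 2 : ℂ).re := by norm_num
  have key (v : n → ℝ) :
      Real.exp (-(1/2) * (v ⬝ᵥ v)) * (z * Complex.exp ((v ⬝ᵥ y : ℝ) * Complex.I)).im =
        Complex.imCLM (z * Complex.exp (-(1 / 2 : ℂ) * ∑ i, (v i : ℂ) ^ 2
          + ∑ i, (y i * Complex.I) * v i)) := by
    have : -(1 / 2 : ℂ) * ∑ i, (v i : ℂ) ^ 2 + ∑ i, (y i * Complex.I) * v i =
        ((-(1/2) * (v ⬝ᵥ v) : ℝ) : ℂ) + (v ⬝ᵥ y : ℝ) * Complex.I := by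
      simp only [dotProduct]
      push_cast
      rw [Finset.sum_mul]
      congr 2
      · simp only [sq]
      · ext i; ring
    rw [this, Complex.exp_add, ← Complex.ofReal_exp, mul_left_comm, Complex.imCLM_apply,
      Complex.im_ofReal_mul]
  simp_rw [key]
  rw [ContinuousLinearMap.integral_comp_comm _
    ((GaussianFourier.integrable_cexp_neg_mul_sum_add hb _).const_mul z), integral_const_mul,
    GaussianFourier.integral_cexp_neg_mul_sum_add hb]
  have h1 : (π / (1 / 2 : ℂ)) ^ (Fintype.card n / 2 : ℂ) =
      (((2 * π) ^ ((Fintype.card n : ℝ) / 2) : ℝ) : ℂ) := by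
    rw [Complex.ofReal_cpow (by positivity)]
    push_cast
    congr 1
    ring
  have h2 : (∑ i, (y i * Complex.I) ^ 2) / (4 * (1 / 2 : ℂ)) =
      ((-(1/2) * (y ⬝ᵥ y) : ℝ) : ℂ) := by
    simp only [mul_pow, Complex.I_sq, dotProduct, ← Finset.sum_mul]
    push_cast
    simp only [sq]
    ring
  rw [h1, h2, ← Complex.ofReal_exp, ← Complex.ofReal_mul, Complex.imCLM_apply, Complex.im_mul_ofReal,
    mul_comm]

theorem integral_cos_add_add (s c α β : ℝ) :
    ∫ b in α..β, Real.cos (s + b + c) = Real.sin (s + c + β) - Real.sin (s + c + α) := by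
  have h (b : ℝ) : s + b + c = b + (s + c) := by ring
  simp_rw [h]
  rw [intervalIntegral.integral_comp_add_right (fun b => Real.cos b), integral_cos]
  ring_nf

theorem sin_sub_sin_eq_im (s t c α β : ℝ) :
    Real.sin (s + t + c + β) - Real.sin (s + t + c + α) =
      ((Complex.exp ((s + c + β : ℝ) * Complex.I) - Complex.exp ((s + c + α : ℝ) * Complex.I)) *
        Complex.exp ((t : ℝ) * Complex.I)).im := by
  rw [sub_mul, ← Complex.exp_add, ← Complex.exp_add, Complex.sub_im, ← add_mul, ← add_mul,
    ← Complex.ofReal_add, ← Complex.ofReal_add, Complex.exp_ofReal_mul_I_im,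
    Complex.exp_ofReal_mul_I_im]
  ring_nf

theorem stmt_7 (Q : ℕ) (hQ : 0 < Q) (μ : Fin Q → ℝ) (S : Matrix (Fin Q) (Fin Q) ℝ)
    (hS : S.PosDef) (x : Fin Q → ℝ) (c : ℝ) (α β : ℝ) (hαβ : α < β) :
    ∫ w : Fin Q → ℝ,
        ((2 * π) ^ Q * S.det) ^ (-(1:ℝ)/2) *
          Real.exp (-(1/2) * ((w - μ) ⬝ᵥ (S⁻¹ *ᵥ (w - μ)))) *
          ((1 / (β - α)) * ∫ b in α..β, Real.cos ((w ⬝ᵥ x) + b + c)) =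
      Real.exp (-(1/2) * (x ⬝ᵥ (S *ᵥ x))) *
        ((Real.sin ((μ ⬝ᵥ x) + c + β) - Real.sin ((μ ⬝ᵥ x) + c + α)) / (β - α)) := by
  obtain ⟨A, hdet, rfl⟩ := hS.exists_mul_transpose
  have hdetT : IsUnit Aᵀ.det := by rw [det_transpose]; exact hdet.isUnit
  have hquad (v : Fin Q → ℝ) : (A *ᵥ v) ⬝ᵥ ((A * Aᵀ)⁻¹ *ᵥ (A *ᵥ v)) = v ⬝ᵥ v := by
    rw [mulVec_mulVec, Matrix.mul_inv_rev, Matrix.mul_assoc, nonsing_inv_mul _ hdet.isUnit,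
      Matrix.mul_one, dotProduct_mulVec, vecMul_mulVec,
      mul_nonsing_inv _ hdetT, vecMul_one]
  have hlin (v : Fin Q → ℝ) : (A *ᵥ v) ⬝ᵥ x = v ⬝ᵥ (Aᵀ *ᵥ x) := by
    rw [dotProduct_mulVec, vecMul_transpose]
  have hcov : x ⬝ᵥ ((A * Aᵀ) *ᵥ x) = (Aᵀ *ᵥ x) ⬝ᵥ (Aᵀ *ᵥ x) := by
    rw [← mulVec_mulVec, dotProduct_mulVec, mulVec_transpose]
  have hnorm : |A.det| * ((2 * π) ^ Q * (A * Aᵀ).det) ^ (-(1:ℝ)/2) *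
      (2 * π) ^ ((Q : ℝ) / 2) = 1 := by
    have h2π : 0 < 2 * π := by positivity
    have hd : (A * Aᵀ).det = |A.det| ^ (2 : ℝ) := by
      rw [det_mul, det_transpose, Real.rpow_two, sq_abs, sq]
    rw [hd, ← Real.rpow_natCast, Real.mul_rpow (by positivity) (by positivity),
      ← Real.rpow_mul h2π.le, ← Real.rpow_mul (abs_nonneg _)]
    have e1 : (2 : ℝ) * (-1 / 2) = -1 := by norm_num
    have e2 : (Q : ℝ) * (-1 / 2) = -(Q / 2) := by ring
    rw [e1, e2, Real.rpow_neg_one, Real.rpow_neg h2π.le]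
    have := (Real.rpow_pos_of_pos h2π ((Q : ℝ) / 2)).ne'
    have := abs_ne_zero.mpr hdet
    field_simp
  rw [integral_comp_add_mulVec hdet μ, hcov]
  simp only [add_sub_cancel_left, hquad, integral_cos_add_add, add_dotProduct, hlin,
    sin_sub_sin_eq_im]
  set z : ℂ := Complex.exp ((μ ⬝ᵥ x + c + β : ℝ) * Complex.I) -
    Complex.exp ((μ ⬝ᵥ x + c + α : ℝ) * Complex.I) with hz
  have hzim : Real.sin (μ ⬝ᵥ x + c + β) - Real.sin (μ ⬝ᵥ x + c + α) = z.im := by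
    rw [hz, Complex.sub_im, Complex.exp_ofReal_mul_I_im, Complex.exp_ofReal_mul_I_im]
  set K := ((2 * π) ^ Q * (A * Aᵀ).det) ^ (-(1:ℝ)/2)
  have hK (a b : ℝ) : K * a * (1 / (β - α) * b) = K / (β - α) * (a * b) := by ring
  simp_rw [hK]
  rw [integral_const_mul, integral_exp_neg_dotProduct_mul_im, Fintype.card_fin, hzim]
  linear_combination (Real.exp (-(1/2) * ((Aᵀ *ᵥ x) ⬝ᵥ (Aᵀ *ᵥ x))) * z.im / (β - α)) * hnorm
end
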